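/- Let E be a number field with ring of integers O, and let ℓ ≥ 5 be a prime that is unramified in E. Let λ₁, …, λ_r be distinct maximal ideals of O lying above ℓ, let O_{λ_i} denote the λ_i-adic completion of O, and let F_{λ_i} = O_{λ_i}/𝔪_{λ_i} be the corresponding residue field. If G is a closed subgroup of GL₂(O_{λ₁}) × ⋯ × GL₂(O_{λ_r}) whose image under componentwise reduction modulo the maximal ideals contains SL₂(F_{λ₁}) × ⋯ × SL₂(F_{λ_r}), then the closure of the commutator subgroup of G equals SL₂(O_{λ₁}) × ⋯ × SL₂(O_{λ_r}). -/

import Mathlib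

open Matrix IsDedekindDomain

/-- The binomial expansion `(1 + N) ^ p = 1 + p * N + N ^ p`, up to a multiple of `p * N ^ 2`. -/
theorem exists_one_add_pow_prime_eq {R : Type*} [Ring R] {p : ℕ} (hp : p.Prime) (N : R) :
    ∃ w, (1 + N) ^ p = 1 + p * N + p * (N ^ 2 * w) + N ^ p := by
  obtain ⟨q, rfl⟩ : ∃ q, p = q + 2 := ⟨p - 2, by have := hp.two_le; omega⟩
  have hdvd : ∀ k ∈ Finset.range q,
      ∃ m : ℕ, (q + 2).choose (k + 2) = (q + 2) * m := fun k hk =>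
    hp.dvd_choose_self (by omega) (by have := Finset.mem_range.1 hk; omega)
  choose! m hm using hdvd
  refine ⟨∑ k ∈ Finset.range q, m k * N ^ k, ?_⟩
  rw [add_comm 1 N, (Commute.one_right N).add_pow, Finset.sum_range_succ,
    Finset.sum_range_succ', Finset.sum_range_succ']
  have hsum : ∑ k ∈ Finset.range q,
      N ^ (k + 1 + 1) * 1 ^ (q + 2 - (k + 1 + 1)) * ((q + 2).choose (k + 1 + 1) : R)
      = ((q + 2 : ℕ) : R) * (N ^ 2 * ∑ k ∈ Finset.range q, m k * N ^ k) := by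
    rw [Finset.mul_sum, Finset.mul_sum]
    refine Finset.sum_congr rfl fun k hk => ?_
    rw [hm k hk, one_pow, mul_one, ← (Nat.cast_commute _ _).eq, Nat.cast_mul,
      (Nat.cast_commute (m k) (N ^ k)).eq, ← mul_assoc (N ^ 2), ← pow_add, mul_assoc,
      (Nat.cast_commute (m k) _).eq, add_assoc, add_comm k]
  rw [hsum]
  simp only [zero_add, pow_one, one_pow, mul_one, Nat.choose_one_right, pow_zero,
    Nat.choose_zero_right, Nat.cast_one, Nat.choose_self,
    ← (Nat.cast_commute (q + 2) N).eq]
  abel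

/-- If `p ^ (n + 1)` divides `N ^ 2`, then `(1 + N) ^ p` is `1 + p * N` modulo `p ^ (n + 2)`. -/
theorem exists_one_add_pow_prime_eq_of_sq {A R : Type*} [CommRing A] [Ring R] [Algebra A R] {p : ℕ}
    (hp : p.Prime) (hp4 : 4 ≤ p) {n : ℕ} {N a : R} (hN : N ^ 2 = (p : A) ^ (n + 1) • a) :
    ∃ w, (1 + N) ^ p = 1 + (p : A) • N + (p : A) ^ (n + 2) • w := by
  obtain ⟨w, hw⟩ := exists_one_add_pow_prime_eq hp N
  refine ⟨a * w + (p : A) ^ n • (a ^ 2 * N ^ (p - 4)), ?_⟩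
  have h4 : N ^ p = (p : A) ^ (2 * n + 2) • (a ^ 2 * N ^ (p - 4)) := by
    rw [show N ^ p = (N ^ 2) ^ 2 * N ^ (p - 4) by rw [← pow_mul, ← pow_add]; congr 1; omega,
      hN, smul_pow, smul_mul_assoc, ← pow_mul]
    congr 2; ring
  have hc (x : R) : (p : R) * x = (p : A) • x := by
    rw [Algebra.smul_def, map_natCast]
  rw [hw, h4, hN, hc, hc, smul_mul_assoc, smul_smul, smul_add, smul_smul]
  rw [← pow_add, ← pow_succ', show n + 2 + n = 2 * n + 2 by ring]
  abel

section

variable {A : Type*} [CommRing A] {p : ℕ} {S : Submonoid (Matrix (Fin 2) (Fin 2) A)}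

/-- `S` contains an element congruent to `1 + p ^ n * u` modulo `p ^ (n + 1)`. -/
def ApproxMem (p : ℕ) (S : Submonoid (Matrix (Fin 2) (Fin 2) A)) (n : ℕ)
    (u : Matrix (Fin 2) (Fin 2) A) : Prop :=
  ∃ w, 1 + (p : A) ^ n • u + (p : A) ^ (n + 1) • w ∈ S

theorem ApproxMem.add {n : ℕ} (hn : n ≠ 0) {u u' : Matrix (Fin 2) (Fin 2) A}
    (h : ApproxMem p S n u) (h' : ApproxMem p S n u') : ApproxMem p S n (u + u') := by
  obtain ⟨w, hw⟩ := h
  obtain ⟨w', hw'⟩ := h'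
  obtain ⟨k, rfl⟩ := Nat.exists_eq_succ_of_ne_zero hn
  refine ⟨w + w' + (p : A) ^ k • ((u + (p : A) • w) * (u' + (p : A) • w')), ?_⟩
  convert S.mul_mem hw hw' using 1
  simp only [add_mul, mul_add, smul_mul_assoc, mul_smul_comm, one_mul, mul_one, Nat.succ_eq_add_one]
  module

theorem ApproxMem.succ (hp : p.Prime) (hp4 : 4 ≤ p) {n : ℕ} (hn : n ≠ 0)
    {u : Matrix (Fin 2) (Fin 2) A} (h : ApproxMem p S n u) : ApproxMem p S (n + 1) u := by
  obtain ⟨w, hw⟩ := h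
  obtain ⟨k, rfl⟩ := Nat.exists_eq_succ_of_ne_zero hn
  obtain ⟨w', hw'⟩ := exists_one_add_pow_prime_eq_of_sq (A := A) hp hp4 (n := k + 1)
    (N := (p : A) ^ (k + 1) • (u + (p : A) • w)) (a := (p : A) ^ k • (u + (p : A) • w) ^ 2)
    (by rw [smul_pow, smul_smul]; congr 1; ring)
  refine ⟨w + w', ?_⟩
  convert S.pow_mem hw p using 1
  rw [add_assoc 1 (_ • u) (_ • w), show (p : A) ^ k.succ • u + (p : A) ^ (k.succ + 1) • w =
    (p : A) ^ (k + 1) • (u + (p : A) • w) by rw [Nat.succ_eq_add_one]; module, hw']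
  simp only [Nat.succ_eq_add_one]
  module

theorem ApproxMem.of_sq_eq_zero (hp : p.Prime) (hp4 : 4 ≤ p)
    (hS : ∀ s : Matrix (Fin 2) (Fin 2) A, s.det = 1 → ∃ w, s + (p : A) • w ∈ S)
    {u : Matrix (Fin 2) (Fin 2) A} (hu : u ^ 2 = 0) (hdet : (1 + u).det = 1) :
    ApproxMem p S 1 u := by
  obtain ⟨w, hw⟩ := hS _ hdet
  obtain ⟨w', hw'⟩ := exists_one_add_pow_prime_eq_of_sq (A := A) hp hp4 (n := 0)
    (N := u + (p : A) • w) (a := u * w + w * u + (p : A) • w ^ 2) (by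
      rw [pow_two] at hu
      simp only [pow_two, add_mul, mul_add, smul_mul_assoc, mul_smul_comm, hu]
      module)
  refine ⟨w + w', ?_⟩
  convert S.pow_mem hw p using 1
  rw [add_assoc 1 u, hw']
  module

theorem approxMem_of_trace_eq_zero (hp : p.Prime) (hp4 : 4 ≤ p)
    (hS : ∀ s : Matrix (Fin 2) (Fin 2) A, s.det = 1 → ∃ w, s + (p : A) • w ∈ S)
    {n : ℕ} (hn : n ≠ 0) {u : Matrix (Fin 2) (Fin 2) A} (hu : u.trace = 0) :
    ApproxMem p S n u := by
  induction n, Nat.one_le_iff_ne_zero.2 hn using Nat.le_induction with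
  | succ n hn' ih => exact (ih (by omega)).succ hp hp4 (by omega)
  | base =>
    have hdecomp : u = !![u 0 0, -u 0 0; u 0 0, -u 0 0] + !![0, u 0 1 + u 0 0; 0, 0]
        + !![0, 0; u 1 0 - u 0 0, 0] := by
      rw [trace_fin_two] at hu
      ext i j
      fin_cases i <;> fin_cases j <;> simp
      linear_combination hu
    rw [hdecomp]
    refine ((ApproxMem.of_sq_eq_zero hp hp4 hS ?_ ?_).add one_ne_zero
      (ApproxMem.of_sq_eq_zero hp hp4 hS ?_ ?_)).add one_ne_zero
      (ApproxMem.of_sq_eq_zero hp hp4 hS ?_ ?_)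
    all_goals simp [pow_two, one_fin_two, det_fin_two]
    rotate_left
    · ring
    all_goals ext i j; fin_cases i <;> fin_cases j <;> simp

/-- A submonoid of `SL₂(A)` that surjects onto `SL₂` modulo `p` surjects onto `SL₂` modulo every
power of `p`. -/
theorem exists_add_pow_smul_mem (hp : p.Prime) (hp4 : 4 ≤ p) (hreg : IsLeftRegular (p : A))
    (hdet : ∀ s ∈ S, s.det = 1)
    (hS : ∀ s : Matrix (Fin 2) (Fin 2) A, s.det = 1 → ∃ w, s + (p : A) • w ∈ S)
    {n : ℕ} (hn : n ≠ 0) {s : Matrix (Fin 2) (Fin 2) A} (hs : s.det = 1) :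
    ∃ w, s + (p : A) ^ n • w ∈ S := by
  induction n, Nat.one_le_iff_ne_zero.2 hn using Nat.le_induction with
  | base => simpa using hS s hs
  | succ n hn' ih =>
    obtain ⟨w, hw⟩ := ih (by omega)
    set h := s + (p : A) ^ n • w with hh
    have hadj : h.adjugate * h = 1 := by rw [adjugate_mul, hdet h hw, one_smul]
    have hadj' : h * h.adjugate = 1 := by rw [mul_adjugate, hdet h hw, one_smul]
    set B := -(h.adjugate * w) with hB
    have hB1 : h.adjugate * s = 1 + (p : A) ^ n • B := by
      rw [show s = h - (p : A) ^ n • w by rw [hh]; abel, mul_sub, hadj, hB, mul_smul_comm]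
      module
    obtain ⟨k, rfl⟩ := Nat.exists_eq_succ_of_ne_zero (Nat.one_le_iff_ne_zero.1 hn')
    have htr : B.trace = (p : A) * (-(p : A) ^ k * B.det) := by
      have hdB : (1 + (p : A) ^ (k + 1) • B).det = 1 := by
        rw [← Nat.succ_eq_add_one, ← hB1, det_mul, hs, det_adjugate, hdet h hw]; simp
      apply (hreg.pow (k + 1))
      simp [det_fin_two] at hdB
      rw [trace_fin_two, det_fin_two]
      dsimp only
      linear_combination hdB
    set t := -(p : A) ^ k * B.det
    obtain ⟨w', hw'⟩ := approxMem_of_trace_eq_zero hp hp4 hS (n := k + 1) (by omega)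
      (u := B - (p : A) • !![t, 0; 0, 0]) (by rw [trace_sub, htr]; simp [trace_fin_two])
    refine ⟨h * (w' - !![t, 0; 0, 0]), ?_⟩
    convert S.mul_mem hw hw' using 1
    rw [show s = h * (1 + (p : A) ^ (k + 1) • B) by
      rw [← Nat.succ_eq_add_one, ← hB1, ← mul_assoc, hadj', one_mul]]
    simp only [mul_add, mul_sub, smul_sub, mul_smul_comm, Nat.succ_eq_add_one]
    module

end

/-- A finite product of groups `SL₂` over fields is perfect as soon as each field contains
an element `a` with `a ≠ 0` and `a ^ 2 ≠ 1`. -/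
theorem commutator_pi_specialLinearGroup_eq_top {ι : Type*} [Finite ι] {F : ι → Type*}
    [∀ i, Field (F i)] (a : ∀ i, F i) (ha : ∀ i, a i ≠ 0) (ha' : ∀ i, a i ^ 2 ≠ 1) :
    commutator (∀ i, SpecialLinearGroup (Fin 2) (F i)) = ⊤ := by
  rw [commutator_def, ← Subgroup.pi_top (η := ι) (f := fun i => SpecialLinearGroup (Fin 2) (F i)) Set.univ,
    Subgroup.commutator_pi_pi_of_finite]
  congr 1
  funext i
  exact SL2.commutator_eq_top (ha i) (ha' i)

theorem det_eq_one_of_mem_commutator {ι : Type*} {R : ι → Type*} [∀ i, CommRing (R i)]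
    {G : Subgroup (∀ i, GL (Fin 2) (R i))} {h : ∀ i, GL (Fin 2) (R i)} (hh : h ∈ ⁅G, G⁆) (i : ι) :
    (h i : Matrix (Fin 2) (Fin 2) (R i)).det = 1 := by
  have := Abelianization.commutator_subset_ker
    (GeneralLinearGroup.det.comp (Pi.evalMonoidHom (fun i => GL (Fin 2) (R i)) i))
    (Subgroup.commutator_mono le_top le_top hh)
  simpa using congrArg Units.val (MonoidHom.mem_ker.1 this)

section

open Filter Topology

variable {ι : Type*} [Finite ι] {R : ι → Type*} [∀ i, CommRing (R i)] [∀ i, IsLocalRing (R i)]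
  {p : ℕ}

/-- If `G` surjects onto `∏ SL₂` of the residue fields, then so does its commutator subgroup. -/
theorem exists_mem_commutator_map_residue_eq (hp : p.Prime) (hp5 : 5 ≤ p)
    (hpR : ∀ i, (p : R i) ∈ IsLocalRing.maximalIdeal (R i))
    (G : Subgroup (∀ i, GL (Fin 2) (R i)))
    (hG : ∀ g : (∀ i, SpecialLinearGroup (Fin 2) (IsLocalRing.ResidueField (R i))),
      ∃ h ∈ G, ∀ i, (h i : Matrix (Fin 2) (Fin 2) (R i)).map (IsLocalRing.residue (R i)) = g i)
    (g : ∀ i, SpecialLinearGroup (Fin 2) (IsLocalRing.ResidueField (R i))) :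
    ∃ h ∈ ⁅G, G⁆, ∀ i,
      (h i : Matrix (Fin 2) (Fin 2) (R i)).map (IsLocalRing.residue (R i)) = g i := by
  have hchar (i) : CharP (IsLocalRing.ResidueField (R i)) p := by
    refine (CharP.charP_iff_prime_eq_zero hp).2 ?_
    rw [← map_natCast (IsLocalRing.residue (R i)), IsLocalRing.residue_eq_zero_iff]
    exact hpR i
  have hne (i) {n : ℕ} (hn0 : n ≠ 0) (hn : n < p) :
      (n : IsLocalRing.ResidueField (R i)) ≠ 0 := by
    rw [Ne, CharP.cast_eq_zero_iff _ p]
    exact fun h => absurd (Nat.le_of_dvd (Nat.pos_of_ne_zero hn0) h) (by omega)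
  let red : (∀ i, GL (Fin 2) (R i)) →* ∀ i, GL (Fin 2) (IsLocalRing.ResidueField (R i)) :=
    MonoidHom.piMap fun i => GeneralLinearGroup.map (IsLocalRing.residue (R i))
  let incl : (∀ i, SpecialLinearGroup (Fin 2) (IsLocalRing.ResidueField (R i))) →*
      ∀ i, GL (Fin 2) (IsLocalRing.ResidueField (R i)) :=
    MonoidHom.piMap fun i => SpecialLinearGroup.toGL
  have hle : (⊤ : Subgroup (∀ i, SpecialLinearGroup (Fin 2) (IsLocalRing.ResidueField (R i)))).map
      incl ≤ G.map red := by
    rintro _ ⟨s, -, rfl⟩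
    obtain ⟨h, hh, hs⟩ := hG s
    exact ⟨h, hh, funext fun i => Units.ext (hs i)⟩
  have hmem : incl g ∈ ⁅G, G⁆.map red := by
    rw [Subgroup.map_commutator]
    refine Subgroup.commutator_mono hle hle ?_
    rw [← Subgroup.map_commutator, ← commutator_def,
      commutator_pi_specialLinearGroup_eq_top (fun _ => 2)
      (fun i => by exact_mod_cast hne i two_ne_zero (by omega)) fun i h => ?_]
    · exact Subgroup.mem_map_of_mem _ (Subgroup.mem_top _)
    · refine hne i three_ne_zero (by omega) ?_
      push_cast
      linear_combination h
  obtain ⟨h, hh, he⟩ := hmem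
  exact ⟨h, hh, fun i => congrArg Units.val (congrFun he i)⟩

/-- If `G` surjects onto `∏ SL₂` of the residue fields, then its commutator subgroup surjects onto
`∏ SL₂` modulo every power of `p`. -/
theorem exists_mem_commutator_eq_add_pow_smul (hp : p.Prime) (hp5 : 5 ≤ p)
    (hmax : ∀ i, IsLocalRing.maximalIdeal (R i) = Ideal.span {(p : R i)})
    (hreg : ∀ i, IsLeftRegular (p : R i))
    (G : Subgroup (∀ i, GL (Fin 2) (R i)))
    (hG : ∀ g : (∀ i, SpecialLinearGroup (Fin 2) (IsLocalRing.ResidueField (R i))),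
      ∃ h ∈ G, ∀ i, (h i : Matrix (Fin 2) (Fin 2) (R i)).map (IsLocalRing.residue (R i)) = g i)
    {n : ℕ} (hn : n ≠ 0) (x : ∀ i, SpecialLinearGroup (Fin 2) (R i)) :
    ∃ h ∈ ⁅G, G⁆, ∃ w : ∀ i, Matrix (Fin 2) (Fin 2) (R i),
      ∀ i, (h i : Matrix (Fin 2) (Fin 2) (R i)) = x i + (p : R i) ^ n • w i := by
  let toMatrixPi : (∀ i, GL (Fin 2) (R i)) →* Matrix (Fin 2) (Fin 2) (∀ i, R i) :=
    { toFun := fun h => Matrix.of fun a b i => (h i : Matrix (Fin 2) (Fin 2) (R i)) a b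
      map_one' := by
        ext a b i
        fin_cases a <;> fin_cases b <;> simp
      map_mul' := fun h h' => by
        ext a b i
        simp [Matrix.mul_apply] }
  have hto (h a b i) : toMatrixPi h a b i = (h i : Matrix (Fin 2) (Fin 2) (R i)) a b := rfl
  obtain ⟨w, h, hh, hw⟩ := exists_add_pow_smul_mem (A := ∀ i, R i) (p := p)
    (S := ⁅G, G⁆.toSubmonoid.map toMatrixPi) hp (by omega)
    (fun a b hab => funext fun i => hreg i (by simpa using congrFun hab i)) (by
      rintro _ ⟨h, hh, rfl⟩
      funext i
      have := det_eq_one_of_mem_commutator hh i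
      rw [det_fin_two] at this ⊢
      simpa [hto] using this) (by
      intro s hs
      have hs' (i) : (s.map fun c => c i).det = 1 := by
        have := congrFun hs i
        rw [det_fin_two] at this ⊢
        simpa using this
      obtain ⟨h, hh, hr⟩ := exists_mem_commutator_map_residue_eq hp hp5
        (fun i => hmax i ▸ Ideal.mem_span_singleton_self _) G hG
        (fun i => SpecialLinearGroup.map (IsLocalRing.residue (R i)) ⟨_, hs' i⟩)
      have hdvd (a b i) : ∃ c, (h i : Matrix (Fin 2) (Fin 2) (R i)) a b = s a b i + p * c := by
        have h0 : (h i : Matrix (Fin 2) (Fin 2) (R i)) a b - s a b i ∈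
            IsLocalRing.maximalIdeal (R i) := by
          rw [← IsLocalRing.residue_eq_zero_iff, map_sub, sub_eq_zero]
          exact congrFun (congrFun (hr i) a) b
        rw [hmax i, Ideal.mem_span_singleton] at h0
        obtain ⟨c, hc⟩ := h0
        exact ⟨c, by rw [← hc]; ring⟩
      choose w hw using hdvd
      refine ⟨Matrix.of w, h, hh, ?_⟩
      ext a b i
      simp [hto, hw]) hn (s := Matrix.of fun a b i => (x i : Matrix (Fin 2) (Fin 2) (R i)) a b) (by
      funext i
      have := (x i).2
      rw [det_fin_two] at this ⊢
      simpa using this)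
  refine ⟨h, hh, fun i => w.map fun c => c i, fun i => ?_⟩
  ext a b
  simpa [hto] using congrFun (congrFun (congrFun hw a) b) i

/-- If `G` surjects onto `∏ SL₂` of the residue fields, then its commutator subgroup is dense in
`∏ SL₂`. -/
theorem closure_commutator_eq_setOf_det_eq_one [∀ i, TopologicalSpace (R i)]
    [∀ i, IsTopologicalRing (R i)] [∀ i, T1Space (R i)] (hp : p.Prime) (hp5 : 5 ≤ p)
    (hmax : ∀ i, IsLocalRing.maximalIdeal (R i) = Ideal.span {(p : R i)})
    (hreg : ∀ i, IsLeftRegular (p : R i))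
    (hlim : ∀ i (c : ℕ → R i), Tendsto (fun n => (p : R i) ^ n * c n) atTop (𝓝 0))
    (G : Subgroup (∀ i, GL (Fin 2) (R i)))
    (hG : ∀ g : (∀ i, SpecialLinearGroup (Fin 2) (IsLocalRing.ResidueField (R i))),
      ∃ h ∈ G, ∀ i, (h i : Matrix (Fin 2) (Fin 2) (R i)).map (IsLocalRing.residue (R i)) = g i) :
    closure ((⁅G, G⁆ : Subgroup (∀ i, GL (Fin 2) (R i))) : Set (∀ i, GL (Fin 2) (R i))) =
      {x | ∀ i, (x i : Matrix (Fin 2) (Fin 2) (R i)).det = 1} := by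
  have hdet : ((⁅G, G⁆ : Subgroup _) : Set (∀ i, GL (Fin 2) (R i))) ⊆
      {x | ∀ i, (x i : Matrix (Fin 2) (Fin 2) (R i)).det = 1} :=
    fun h hh i => det_eq_one_of_mem_commutator hh i
  refine (closure_minimal hdet ?_).antisymm fun x hx => ?_
  · simp only [Set.ofPred_forall]
    refine isClosed_iInter fun i => isClosed_singleton.preimage
      (f := fun x : ∀ i, GL (Fin 2) (R i) => (x i : Matrix (Fin 2) (Fin 2) (R i)).det) ?_
    exact (Units.continuous_val.comp (continuous_apply i)).matrix_det
  · choose h hh w hw using fun n : ℕ => exists_mem_commutator_eq_add_pow_smul hp hp5 hmax hreg G hG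
      n.succ_ne_zero fun i => ⟨x i, hx i⟩
    refine mem_closure_of_tendsto (f := h) (b := atTop) (tendsto_pi_nhds.2 fun i => ?_)
      (Eventually.of_forall hh)
    have hSL : Tendsto (fun n => (⟨h n i, hdet (hh n) i⟩ : SpecialLinearGroup (Fin 2) (R i))) atTop
        (𝓝 ⟨x i, hx i⟩) := by
      refine tendsto_subtype_rng.2 (tendsto_pi_nhds.2 fun a => tendsto_pi_nhds.2 fun b => ?_)
      simp only [hw]
      simpa [pow_succ, mul_assoc] using
        (hlim i fun n => p * w n i a b).const_add ((x i : Matrix (Fin 2) (Fin 2) (R i)) a b)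
    have := (SpecialLinearGroup.continuous_toGL.tendsto _).comp hSL
    convert this using 1
    · funext n
      exact Units.ext rfl
    · exact congrArg _ (Units.ext rfl)

end

section

open IsDedekindDomain.HeightOneSpectrum WithZero Filter Topology

variable {R : Type*} [CommRing R] [IsDedekindDomain R] (K : Type*) [Field K] [Algebra R K]
  [IsFractionRing R K] (v : HeightOneSpectrum R)

/-- An element generating a squarefree ideal contained in `v` is a uniformizer at `v`. -/
theorem intValuation_eq_exp_neg_one_of_squarefree {a : R} (ha : Squarefree (Ideal.span {a}))
    (hav : a ∈ v.asIdeal) : v.intValuation a = exp (-1) := by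
  have h1 : v.intValuation a ≤ exp (-1) := by
    simpa using (v.intValuation_le_pow_iff_mem a 1).2 (by simpa using hav)
  refine h1.antisymm (not_lt.1 fun h => ?_)
  have h2 : v.intValuation a ≤ exp (-((2 : ℕ) : ℤ)) := by
    rcases eq_or_ne a 0 with rfl | ha0
    · simp
    · rw [v.intValuation_eq_exp_neg_multiplicity ha0, exp_lt_exp] at h
      rw [v.intValuation_eq_exp_neg_multiplicity ha0, exp_le_exp]
      omega
  rw [intValuation_le_pow_iff_dvd, pow_two] at h2
  exact v.isPrime.ne_top (Ideal.isUnit_iff.1 (ha _ h2))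

variable {K v}

theorem maximalIdeal_adicCompletionIntegers_eq_span {π : v.adicCompletionIntegers K}
    (hπ : Valued.v (π : v.adicCompletion K) = exp (-1)) :
    IsLocalRing.maximalIdeal (v.adicCompletionIntegers K) = Ideal.span {π} := by
  have hπ0 : (π : v.adicCompletion K) ≠ 0 := fun h =>
    exp_ne_zero (hπ.symm.trans (by rw [h, map_zero]))
  ext x
  rw [IsLocalRing.mem_maximalIdeal, mem_nonunits_iff,
    adicCompletionIntegers.isUnit_iff_valued_eq_one, Ideal.mem_span_singleton]
  constructor
  · intro hx
    have hx1 : Valued.v (x : v.adicCompletion K) ≤ exp (-1) := by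
      rw [← lt_mul_exp_iff_le exp_ne_zero, ← exp_add]
      simpa using lt_of_le_of_ne x.2 hx
    refine ⟨⟨x / π, ?_⟩, Subtype.ext (by simp [mul_div_cancel₀, hπ0])⟩
    rw [mem_adicCompletionIntegers, map_div₀, hπ]
    exact div_le_one_of_le₀ hx1 zero_le
  · rintro ⟨c, rfl⟩ h
    have hc : Valued.v (c : v.adicCompletion K) ≤ 1 := c.2
    rw [MulMemClass.coe_mul, map_mul, hπ] at h
    have := h ▸ mul_le_of_le_one_right' hc
    exact absurd this (by rw [← exp_zero, exp_le_exp]; simp)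

theorem tendsto_pow_mul_adicCompletionIntegers {π : v.adicCompletionIntegers K}
    (hπ : Valued.v (π : v.adicCompletion K) = exp (-1)) (c : ℕ → v.adicCompletionIntegers K) :
    Tendsto (fun n => π ^ n * c n) atTop (𝓝 0) := by
  rw [tendsto_subtype_rng]
  refine (Valued.hasBasis_nhds_zero _ _).tendsto_right_iff.2 fun γ _ => ?_
  obtain ⟨n, hn⟩ := Valued.exists_pow_lt_of_le_exp_neg_one hπ.le
    (Units.map (MonoidWithZeroHom.ValueGroup₀.embedding
      (f := .ofClass (Valued.v (R := v.adicCompletion K)))) γ)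
  filter_upwards [eventually_ge_atTop n] with m hm
  have hc : Valued.v (c m : v.adicCompletion K) ≤ 1 := (c m).2
  rw [Valuation.restrict_lt_iff_lt_embedding]
  refine lt_of_le_of_lt ?_ hn
  rw [MulMemClass.coe_mul, SubmonoidClass.coe_pow, map_mul, map_pow]
  refine (mul_le_of_le_one_right' hc).trans (pow_le_pow_right_of_le_one' ?_ hm)
  exact π.2

end

theorem stmt7 (E : Type*) [Field E] [NumberField E] (ℓ : ℕ) (hprime : Nat.Prime ℓ) (hℓ : 5 ≤ ℓ)
    (hunram : Squarefree (Ideal.span {(ℓ : NumberField.RingOfIntegers E)}))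
    (r : ℕ) (hr : 1 ≤ r)
    (v : Fin r → HeightOneSpectrum (NumberField.RingOfIntegers E))
    (hdistinct : Function.Injective v)
    (habove : ∀ i, (ℓ : NumberField.RingOfIntegers E) ∈ (v i).asIdeal)
    (G : Subgroup (∀ i, GL (Fin 2) ((v i).adicCompletionIntegers E)))
    (hclosed : IsClosed (G : Set (∀ i, GL (Fin 2) ((v i).adicCompletionIntegers E))))
    (hsurj : ∀ g : (∀ i, SpecialLinearGroup (Fin 2)
        (IsLocalRing.ResidueField ((v i).adicCompletionIntegers E))),
      ∃ h ∈ G, ∀ i,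
        (↑(h i) : Matrix (Fin 2) (Fin 2) ((v i).adicCompletionIntegers E)).map
            (IsLocalRing.residue ((v i).adicCompletionIntegers E))
          = ↑(g i)) :
    closure ((⁅G, G⁆ : Subgroup (∀ i, GL (Fin 2) ((v i).adicCompletionIntegers E))) :
        Set (∀ i, GL (Fin 2) ((v i).adicCompletionIntegers E)))
      = {x : ∀ i, GL (Fin 2) ((v i).adicCompletionIntegers E) |
          ∀ i, (↑(x i) : Matrix (Fin 2) (Fin 2) ((v i).adicCompletionIntegers E)).det = 1} := by
  have hval (i) : Valued.v (((ℓ : (v i).adicCompletionIntegers E) : (v i).adicCompletion E)) =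
      WithZero.exp (-1) := by
    rw [← intValuation_eq_exp_neg_one_of_squarefree (v i) hunram (habove i),
      ← HeightOneSpectrum.valuation_of_algebraMap (K := E),
      ← HeightOneSpectrum.valuedAdicCompletion_eq_valuation]
    simp
  have hne (i) : (ℓ : (v i).adicCompletionIntegers E) ≠ 0 := fun h =>
    WithZero.exp_ne_zero ((hval i).symm.trans (by rw [h]; simp))
  exact closure_commutator_eq_setOf_det_eq_one hprime hℓ
    (fun i => maximalIdeal_adicCompletionIntegers_eq_span (hval i))
    (fun i => (IsRegular.of_ne_zero (hne i)).left)
    (fun i => tendsto_pow_mul_adicCompletionIntegers (hval i)) G hsurj
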